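/- Let Λ = {k ∈ ℤ³ : k₁+k₂+k₃ = 0, k₁ ≥ 0, k₂ ≥ 0, k₃ ≤ 0} and Λ° = {k ∈ Λ : k₁ > 0, k₂ > 0, k₃ < 0}. Then for all k, j ∈ Λ: ⟨TC_k, TC_j⟩_Δ = 0 if k ≠ j, ⟨TC_k, TC_k⟩_Δ = 1 if k = 0, ⟨TC_k, TC_k⟩_Δ = 1/3 if k ∈ Λ \ Λ° and k ≠ 0, and ⟨TC_k, TC_k⟩_Δ = 1/6 if k ∈ Λ°. Moreover, for all k, j ∈ Λ°: ⟨TS_k, TS_j⟩_Δ = (1/6)·δ_{k,j}. -/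

import Mathlib

open MeasureTheory
open scoped Real Classical

noncomputable section

/-- `φ_j(t) = exp(2πi (j₁t₁ + j₂t₂ + j₃t₃)/3)` for `j ∈ ℤ³`, `t ∈ ℝ³`. -/
def phi (j : ℤ × ℤ × ℤ) (t : ℝ × ℝ × ℝ) : ℂ :=
  Complex.exp (2 * (Real.pi : ℂ) * Complex.I *
    ((j.1 : ℂ) * (t.1 : ℂ) + (j.2.1 : ℂ) * (t.2.1 : ℂ) + (j.2.2 : ℂ) * (t.2.2 : ℂ)) / 3)

/-- The generalized cosine `TC_k`. -/
def TCos (k : ℤ × ℤ × ℤ) (t : ℝ × ℝ × ℝ) : ℂ :=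
  (1 / 6) * (phi k t + phi (k.2.1, k.2.2, k.1) t + phi (k.2.2, k.1, k.2.1) t +
    phi (-k.1, -k.2.2, -k.2.1) t + phi (-k.2.1, -k.1, -k.2.2) t +
    phi (-k.2.2, -k.2.1, -k.1) t)

/-- The generalized sine `TS_k`. -/
def TSin (k : ℤ × ℤ × ℤ) (t : ℝ × ℝ × ℝ) : ℂ :=
  (1 / (6 * Complex.I)) * (phi k t + phi (k.2.1, k.2.2, k.1) t + phi (k.2.2, k.1, k.2.1) t -
    phi (-k.1, -k.2.2, -k.2.1) t - phi (-k.2.1, -k.1, -k.2.2) t -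
    phi (-k.2.2, -k.2.1, -k.1) t)

/-- The point `j/n = (j₁/n, j₂/n, j₃/n)`. -/
def pt (n : ℕ) (j : ℤ × ℤ × ℤ) : ℝ × ℝ × ℝ :=
  ((j.1 : ℝ) / n, (j.2.1 : ℝ) / n, (j.2.2 : ℝ) / n)

/-- The triangle `Δ = {(t₁,t₂) : t₁ ≥ 0, t₂ ≥ 0, t₁+t₂ ≤ 1}`. -/
def TriDelta : Set (ℝ × ℝ) := {p | 0 ≤ p.1 ∧ 0 ≤ p.2 ∧ p.1 + p.2 ≤ 1}

/-- Embedding `(t₁,t₂) ↦ (t₁,t₂,-t₁-t₂)` into the plane `t₁+t₂+t₃=0`. -/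
def emb (p : ℝ × ℝ) : ℝ × ℝ × ℝ := (p.1, p.2, -p.1 - p.2)

/-- `⟨f,g⟩_Δ = 2 ∫_Δ f(t₁,t₂,-t₁-t₂) conj(g(t₁,t₂,-t₁-t₂)) dt₁dt₂`. -/
def innerD (f g : ℝ × ℝ × ℝ → ℂ) : ℂ :=
  2 * ∫ p in TriDelta, f (emb p) * (starRingEnd ℂ) (g (emb p))

/-- `Λ = {k ∈ ℍ : k₁ ≥ 0, k₂ ≥ 0, k₃ ≤ 0}`. -/
def Lam : Set (ℤ × ℤ × ℤ) :=
  {k | k.1 + k.2.1 + k.2.2 = 0 ∧ 0 ≤ k.1 ∧ 0 ≤ k.2.1 ∧ k.2.2 ≤ 0}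

/-- `Λ° = {k ∈ Λ : k₁ > 0, k₂ > 0, k₃ < 0}`. -/
def LamCirc : Set (ℤ × ℤ × ℤ) :=
  {k | k.1 + k.2.1 + k.2.2 = 0 ∧ 0 < k.1 ∧ 0 < k.2.1 ∧ k.2.2 < 0}

/-- `Λ_n = {k ∈ Λ : -k₃ ≤ n}`. -/
def Lamn (n : ℕ) : Set (ℤ × ℤ × ℤ) :=
  {k | k.1 + k.2.1 + k.2.2 = 0 ∧ 0 ≤ k.1 ∧ 0 ≤ k.2.1 ∧ -k.2.2 ≤ (n : ℤ)}

/-- `Λ_n° = {k ∈ Λ_n : k₁ > 0, k₂ > 0, -k₃ < n}`. -/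
def LamnCirc (n : ℕ) : Set (ℤ × ℤ × ℤ) :=
  {k | k.1 + k.2.1 + k.2.2 = 0 ∧ 0 < k.1 ∧ 0 < k.2.1 ∧ -k.2.2 < (n : ℤ)}

/-- Weights `λ_j^{(n)}`: 6 on interior points, 1 on the three vertices, 3 on edge points. -/
def lamwt (n : ℕ) (j : ℤ × ℤ × ℤ) : ℝ :=
  if 0 < j.1 ∧ 0 < j.2.1 ∧ -j.2.2 < (n : ℤ) then 6
  else if j = ((n : ℤ), 0, -(n : ℤ)) ∨ j = (0, (n : ℤ), -(n : ℤ)) ∨ j = (0, 0, 0) then 1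
  else 3

theorem triDelta_subset : TriDelta ⊆ Set.Icc (0 : ℝ) 1 ×ˢ Set.Icc (0 : ℝ) 1 := by
  rintro ⟨x, y⟩ ⟨hx, hy, hxy⟩
  simp only [Set.mem_prod, Set.mem_Icc] at *
  refine ⟨⟨hx, ?_⟩, hy, ?_⟩ <;> linarith

theorem isCompact_triDelta : IsCompact TriDelta := by
  have hclosed : IsClosed TriDelta :=
    (isClosed_le continuous_const continuous_fst).inter
      ((isClosed_le continuous_const continuous_snd).inter
        (isClosed_le (continuous_fst.add continuous_snd) continuous_const))
  refine (isCompact_Icc.prod isCompact_Icc).of_isClosed_subset hclosed triDelta_subset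

/-- The integral of a continuous function over the triangle is an iterated interval integral. -/
theorem setIntegral_triDelta {f : ℝ × ℝ → ℂ} (hf : Continuous f) :
    ∫ p in TriDelta, f p = ∫ x in (0 : ℝ)..1, ∫ y in (0 : ℝ)..(1 - x), f (x, y) := by
  have hint : Integrable (TriDelta.indicator f) (volume.prod volume) :=
    (integrable_indicator_iff isCompact_triDelta.measurableSet).2
      (hf.continuousOn.integrableOn_compact isCompact_triDelta)
  rw [← integral_indicator isCompact_triDelta.measurableSet, Measure.volume_eq_prod,
    integral_prod _ hint, intervalIntegral.integral_of_le zero_le_one, ← integral_Icc_eq_integral_Ioc,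
    ← integral_indicator measurableSet_Icc]
  congr 1 with x
  by_cases hx : x ∈ Set.Icc (0 : ℝ) 1
  · rw [Set.indicator_of_mem hx, intervalIntegral.integral_of_le (by linarith [hx.2]),
      ← integral_Icc_eq_integral_Ioc, ← integral_indicator measurableSet_Icc]
    congr 1 with y
    have : (x, y) ∈ TriDelta ↔ y ∈ Set.Icc (0 : ℝ) (1 - x) := by
      simp only [TriDelta, Set.mem_ofPred_eq, Set.mem_Icc]
      exact ⟨fun h => ⟨h.2.1, by linarith [h.2.2]⟩, fun h => ⟨hx.1, h.1, by linarith [h.2]⟩⟩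
    simp only [Set.indicator_apply, this]
  · rw [Set.indicator_of_notMem hx]
    refine integral_eq_zero_of_ae (Filter.Eventually.of_forall fun y => ?_)
    exact Set.indicator_of_notMem (fun h => hx (triDelta_subset h).1) _

/-- The iterated integral of `exp (αx + βy)` over the triangle. -/
def triExp (α β : ℂ) : ℂ :=
  ∫ x in (0 : ℝ)..1, ∫ y in (0 : ℝ)..(1 - x), Complex.exp (α * x + β * y)

theorem triExp_zero_zero : triExp 0 0 = 1 / 2 := by
  have h : triExp 0 0 = ((∫ x in (0 : ℝ)..1, (1 - x) : ℝ) : ℂ) := by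
    rw [← intervalIntegral.integral_ofReal]
    simp [triExp]
  rw [h, intervalIntegral.integral_sub (by simp) (by simp)]
  norm_num

theorem triExp_of_ne_zero (α : ℂ) {β : ℂ} (hβ : β ≠ 0) :
    triExp α β = (Complex.exp β * (∫ x in (0 : ℝ)..1, Complex.exp ((α - β) * x)) -
      ∫ x in (0 : ℝ)..1, Complex.exp (α * x)) / β := by
  have inner (x : ℝ) : ∫ y in (0 : ℝ)..(1 - x), Complex.exp (α * x + β * y) =
      (Complex.exp β * Complex.exp ((α - β) * x) - Complex.exp (α * x)) / β := by
    simp only [Complex.exp_add, intervalIntegral.integral_const_mul]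
    rw [integral_exp_mul_complex hβ, mul_div_assoc', mul_sub, ← Complex.exp_add,
      ← Complex.exp_add, ← Complex.exp_add]
    congr 3 <;> push_cast <;> ring_nf
  rw [triExp]
  simp only [inner, intervalIntegral.integral_div]
  rw [intervalIntegral.integral_sub, intervalIntegral.integral_const_mul]
  all_goals exact Continuous.intervalIntegrable (by fun_prop) _ _

theorem triExp_generic {α β : ℂ} (hα : α ≠ 0) (hβ : β ≠ 0) (hαβ : α - β ≠ 0) :
    triExp α β = Complex.exp α / (α * (α - β)) - Complex.exp β / (β * (α - β)) + 1 / (α * β) := by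
  rw [triExp_of_ne_zero α hβ, integral_exp_mul_complex hαβ, integral_exp_mul_complex hα]
  simp only [Complex.ofReal_one, Complex.ofReal_zero, mul_one, mul_zero, Complex.exp_zero,
    Complex.exp_sub]
  have := Complex.exp_ne_zero β
  field_simp
  ring

theorem triExp_zero_left {β : ℂ} (hβ : β ≠ 0) (h : Complex.exp β = 1) :
    triExp 0 β = -1 / β := by
  rw [triExp_of_ne_zero 0 hβ, integral_exp_mul_complex (by simpa using hβ)]
  simp [Complex.exp_neg, h]

theorem triExp_self {α : ℂ} (hα : α ≠ 0) (h : Complex.exp α = 1) :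
    triExp α α = 1 / α := by
  rw [triExp_of_ne_zero α hα, integral_exp_mul_complex hα]
  simp [h]

theorem triExp_zero_right {α : ℂ} (hα : α ≠ 0) (h : Complex.exp α = 1) :
    triExp α 0 = -1 / α := by
  have inner (x : ℝ) : ∫ y in (0 : ℝ)..(1 - x), Complex.exp (α * x + 0 * y) =
      Complex.exp (α * x) * (1 - x) := by
    simp [mul_comm]
  rw [triExp]
  simp only [inner]
  have hderiv (x : ℝ) : HasDerivAt
      (fun x : ℝ => Complex.exp (α * x) * (1 - x) / α + Complex.exp (α * x) / α ^ 2)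
      (Complex.exp (α * x) * (1 - x)) x := by
    have h1 : HasDerivAt (fun x : ℝ => (x : ℂ)) 1 x := Complex.ofRealCLM.hasDerivAt
    have h2 := (h1.const_mul α).cexp
    refine (((h2.mul (h1.const_sub 1)).div_const α).add (h2.div_const (α ^ 2))).congr_deriv ?_
    field_simp
    ring
  rw [intervalIntegral.integral_eq_sub_of_hasDerivAt (fun x _ => hderiv x)
    (Continuous.intervalIntegrable (by fun_prop) _ _)]
  simp [h]
  ring

/-- The frequency unit `2πi/3`. -/
def freq : ℂ := 2 * (Real.pi : ℂ) * Complex.I / 3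

theorem freq_ne_zero : freq ≠ 0 := by
  simp [freq, Real.pi_ne_zero]

theorem exp_freq_mul_add_three_mul (a n : ℤ) :
    Complex.exp (freq * ((a + 3 * n : ℤ) : ℂ)) = Complex.exp (freq * a) := by
  refine Complex.exp_eq_exp_iff_exists_int.2 ⟨n, ?_⟩
  simp only [freq]
  push_cast
  ring

theorem exp_freq_mul_eq_one {a : ℤ} (h : 3 ∣ a) : Complex.exp (freq * a) = 1 := by
  obtain ⟨n, rfl⟩ := h
  simpa using exp_freq_mul_add_three_mul 0 n

theorem continuous_phi_emb (m : ℤ × ℤ × ℤ) : Continuous fun p : ℝ × ℝ => phi m (emb p) := by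
  unfold phi emb
  fun_prop

theorem setIntegral_phi (a b c : ℤ) :
    ∫ p in TriDelta, phi (a, b, c) (emb p) =
      triExp (freq * ((a - c : ℤ) : ℂ)) (freq * ((b - c : ℤ) : ℂ)) := by
  rw [setIntegral_triDelta (continuous_phi_emb _), triExp]
  congr! 5 with x y
  simp only [phi, emb, freq]
  push_cast
  ring_nf

theorem triExp_cyclic_sum {p q r : ℤ} (hsum : p + q + r = 0) (hpq : 3 ∣ p - q)
    (hp : p ≠ 0) (hq : q ≠ 0) (hr : r ≠ 0) :
    triExp (freq * ((-r : ℤ) : ℂ)) (freq * q) + triExp (freq * ((-p : ℤ) : ℂ)) (freq * r) +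
      triExp (freq * ((-q : ℤ) : ℂ)) (freq * p) = 0 := by
  have key (p q r : ℤ) (hsum : p + q + r = 0) (hp : p ≠ 0) (hq : q ≠ 0) (hr : r ≠ 0) :
      triExp (freq * ((-r : ℤ) : ℂ)) (freq * q) =
        -(Complex.exp (freq * ((-r : ℤ) : ℂ)) / (r * p) + Complex.exp (freq * q) / (q * p) +
          1 / (r * q)) / freq ^ 2 := by
    have hf := freq_ne_zero
    have hp' : (p : ℂ) ≠ 0 := by exact_mod_cast hp
    have hq' : (q : ℂ) ≠ 0 := by exact_mod_cast hq
    have hr' : (r : ℂ) ≠ 0 := by exact_mod_cast hr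
    have hd : freq * ((-r : ℤ) : ℂ) - freq * q = freq * p := by
      have : (p : ℂ) + q + r = 0 := by exact_mod_cast hsum
      push_cast
      linear_combination -freq * this
    rw [triExp_generic (by simp [hf, hr]) (by simp [hf, hq]) (hd ▸ by simp [hf, hp]), hd]
    generalize Complex.exp (freq * ((-r : ℤ) : ℂ)) = u
    push_cast
    field_simp
    ring
  rw [key p q r hsum hp hq hr, key q r p (by lia) hq hr hp, key r p q (by lia) hr hp hq]
  obtain ⟨n, hn⟩ := hpq
  have e1 : Complex.exp (freq * q) = Complex.exp (freq * p) := by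
    rw [← exp_freq_mul_add_three_mul q n]; congr 3; lia
  have e2 : Complex.exp (freq * r) = Complex.exp (freq * p) := by
    rw [← exp_freq_mul_add_three_mul r (p - n)]; congr 3; lia
  have e3 : Complex.exp (freq * ((-q : ℤ) : ℂ)) = Complex.exp (freq * ((-p : ℤ) : ℂ)) := by
    push_cast; rw [mul_neg, mul_neg, Complex.exp_neg, Complex.exp_neg, e1]
  have e4 : Complex.exp (freq * ((-r : ℤ) : ℂ)) = Complex.exp (freq * ((-p : ℤ) : ℂ)) := by
    push_cast; rw [mul_neg, mul_neg, Complex.exp_neg, Complex.exp_neg, e2]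
  rw [e1, e2, e3, e4]
  have hf := freq_ne_zero
  have hp' : (p : ℂ) ≠ 0 := by exact_mod_cast hp
  have hq' : (q : ℂ) ≠ 0 := by exact_mod_cast hq
  have hr' : (r : ℂ) ≠ 0 := by exact_mod_cast hr
  have hs : (r : ℂ) = -p - q := by
    have : (p : ℂ) + q + r = 0 := by exact_mod_cast hsum
    linear_combination this
  generalize Complex.exp (freq * ((-p : ℤ) : ℂ)) = u
  generalize Complex.exp (freq * p) = v
  field_simp
  rw [hs]
  ring

theorem triExp_cyclic_sum_degenerate {q : ℤ} (hq : q ≠ 0) (h3 : 3 ∣ q) :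
    triExp (freq * q) (freq * q) + triExp 0 (freq * ((-q : ℤ) : ℂ)) +
      triExp (freq * ((-q : ℤ) : ℂ)) 0 = 3 / (freq * q) := by
  have hf := freq_ne_zero
  have hq' : (q : ℂ) ≠ 0 := by exact_mod_cast hq
  have e1 := exp_freq_mul_eq_one h3
  have e2 := exp_freq_mul_eq_one ((dvd_neg).2 h3)
  rw [triExp_self (by simp [hf, hq]) e1, triExp_zero_left (by simp [hf, hq]) e2,
    triExp_zero_right (by simp [hf, hq]) e2]
  push_cast
  field_simp
  norm_num

theorem triExp_orbit_sum {p q r : ℤ} (hsum : p + q + r = 0) (hpq : 3 ∣ p - q)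
    (hne : ¬(p = 0 ∧ q = 0)) :
    triExp (freq * ((-r : ℤ) : ℂ)) (freq * q) + triExp (freq * ((-p : ℤ) : ℂ)) (freq * r) +
      triExp (freq * ((-q : ℤ) : ℂ)) (freq * p) + triExp (freq * ((-p : ℤ) : ℂ)) (freq * q) +
      triExp (freq * ((-q : ℤ) : ℂ)) (freq * r) + triExp (freq * ((-r : ℤ) : ℂ)) (freq * p) = 0 := by
  have degenerate {s : ℤ} (hs : s ≠ 0) (h3 : 3 ∣ s) :
      triExp (freq * s) (freq * s) + triExp 0 (freq * ((-s : ℤ) : ℂ)) +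
        triExp (freq * ((-s : ℤ) : ℂ)) 0 +
        triExp (freq * ((-s : ℤ) : ℂ)) (freq * ((-s : ℤ) : ℂ)) + triExp 0 (freq * s) + triExp (freq * s) 0 = 0 := by
    have h1 := triExp_cyclic_sum_degenerate hs h3
    have h2 := triExp_cyclic_sum_degenerate (neg_ne_zero.2 hs) (dvd_neg.2 h3)
    rw [neg_neg] at h2
    have h3 : 3 / (freq * ((-s : ℤ) : ℂ)) = -(3 / (freq * s)) := by
      push_cast
      rw [mul_neg, div_neg]
    linear_combination h1 + h2 + h3
  by_cases hp : p = 0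
  · obtain rfl : r = -q := by lia
    subst hp
    have h := degenerate (s := q) (by lia) (by lia)
    simp only [neg_neg, neg_zero, Int.cast_zero, mul_zero]
    linear_combination h
  by_cases hq : q = 0
  · obtain rfl : r = -p := by lia
    subst hq
    have h := degenerate hp (by lia)
    simp only [neg_neg, neg_zero, Int.cast_zero, mul_zero]
    linear_combination h
  by_cases hr : r = 0
  · obtain rfl : q = -p := by lia
    subst hr
    have h := degenerate hp (by lia)
    simp only [neg_neg, neg_zero, Int.cast_zero, mul_zero]
    linear_combination h
  have h1 := triExp_cyclic_sum hsum hpq hp hq hr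
  have h2 := triExp_cyclic_sum (p := r) (q := q) (r := p) (by lia) (by lia) hr hq hp
  linear_combination h1 + h2

theorem integrableOn_phi (m : ℤ × ℤ × ℤ) : IntegrableOn (fun p => phi m (emb p)) TriDelta :=
  (continuous_phi_emb m).continuousOn.integrableOn_compact isCompact_triDelta

theorem integrableOn_TCos (m : ℤ × ℤ × ℤ) : IntegrableOn (fun p => TCos m (emb p)) TriDelta :=
  ((((((integrableOn_phi _).add (integrableOn_phi _)).add (integrableOn_phi _)).add
    (integrableOn_phi _)).add (integrableOn_phi _)).add (integrableOn_phi _)).const_mul _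

theorem setIntegral_TCos (a b c : ℤ) (hsum : a + b + c = 0) :
    ∫ p in TriDelta, TCos (a, b, c) (emb p) = (1 / 2) * if (a, b, c) = (0, 0, 0) then 1 else 0 := by
  have hφ (m : ℤ × ℤ × ℤ) :
      Integrable (fun p => phi m (emb p)) (volume.restrict TriDelta) := integrableOn_phi m
  simp only [TCos]
  rw [integral_const_mul, integral_add, integral_add, integral_add, integral_add, integral_add]
  · simp only [setIntegral_phi]
    split_ifs with h
    · simp only [Prod.mk.injEq] at h
      obtain ⟨rfl, rfl, rfl⟩ := h
      norm_num [triExp_zero_zero]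
    · simp only [Prod.mk.injEq] at h
      have key := triExp_orbit_sum (p := a - b) (q := b - c) (r := c - a) (by ring) (by lia)
        (by lia)
      simp only [neg_sub] at key
      simp only [neg_sub_neg]
      rw [key, mul_zero, mul_zero]
  all_goals fun_prop

theorem phi_sub (a b c d e f : ℤ) (t : ℝ × ℝ × ℝ) :
    phi (a - b, c - d, e - f) t = phi (a, c, e) t * (starRingEnd ℂ) (phi (b, d, f) t) := by
  simp only [phi, ← Complex.exp_conj, ← Complex.exp_add]
  simp only [map_div₀, map_mul, map_add, Complex.conj_I, Complex.conj_ofReal, map_intCast,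
    map_ofNat]
  push_cast
  ring_nf

theorem phi_neg_sub (a b c d e f : ℤ) (t : ℝ × ℝ × ℝ) :
    phi (-(a - b), -(c - d), -(e - f)) t =
      phi (-a, -c, -e) t * (starRingEnd ℂ) (phi (-b, -d, -f) t) := by
  rw [← phi_sub]
  congr! 2
  · ring
  · congr! 1 <;> ring

theorem TCos_mul_conj (a b c a' b' c' : ℤ) (t : ℝ × ℝ × ℝ) :
    TCos (a, b, c) t * (starRingEnd ℂ) (TCos (a', b', c') t) =
      (1 / 6) * (TCos (a - a', b - b', c - c') t + TCos (a - b', b - c', c - a') t +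
        TCos (a - c', b - a', c - b') t + TCos (a - -a', b - -c', c - -b') t +
        TCos (a - -b', b - -a', c - -c') t + TCos (a - -c', b - -b', c - -a') t) := by
  simp only [TCos, phi_sub, phi_neg_sub, neg_neg, map_mul, map_add, map_div₀, map_one, map_ofNat]
  ring

theorem TSin_mul_conj (a b c a' b' c' : ℤ) (t : ℝ × ℝ × ℝ) :
    TSin (a, b, c) t * (starRingEnd ℂ) (TSin (a', b', c') t) =
      (1 / 6) * (TCos (a - a', b - b', c - c') t + TCos (a - b', b - c', c - a') t +
        TCos (a - c', b - a', c - b') t - TCos (a - -a', b - -c', c - -b') t -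
        TCos (a - -b', b - -a', c - -c') t - TCos (a - -c', b - -b', c - -a') t) := by
  have hI : 1 / (6 * Complex.I) * (1 / (6 * -Complex.I)) = 1 / 36 := by
    field_simp
    norm_num
  simp only [TCos, TSin, phi_sub, phi_neg_sub, neg_neg, map_mul, map_add, map_sub, map_div₀,
    map_one, map_ofNat, Complex.conj_I]
  rw [mul_mul_mul_comm, hI]
  ring

theorem innerD_TCos {a b c a' b' c' : ℤ} (h : a + b + c = 0) (h' : a' + b' + c' = 0) :
    innerD (TCos (a, b, c)) (TCos (a', b', c')) =
      (1 / 6) * ((if (a, b, c) = (a', b', c') then 1 else 0) +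
        (if (a, b, c) = (b', c', a') then 1 else 0) +
        (if (a, b, c) = (c', a', b') then 1 else 0) +
        (if (a, b, c) = (-a', -c', -b') then 1 else 0) +
        (if (a, b, c) = (-b', -a', -c') then 1 else 0) +
        (if (a, b, c) = (-c', -b', -a') then 1 else 0)) := by
  have hT (m : ℤ × ℤ × ℤ) :
      Integrable (fun p => TCos m (emb p)) (volume.restrict TriDelta) := integrableOn_TCos m
  simp only [innerD, TCos_mul_conj]
  rw [integral_const_mul, integral_add, integral_add, integral_add, integral_add, integral_add]
  · rw [setIntegral_TCos _ _ _ (by lia), setIntegral_TCos _ _ _ (by lia),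
      setIntegral_TCos _ _ _ (by lia), setIntegral_TCos _ _ _ (by lia),
      setIntegral_TCos _ _ _ (by lia), setIntegral_TCos _ _ _ (by lia)]
    simp only [Prod.mk.injEq, sub_eq_zero]
    ring
  all_goals fun_prop

theorem innerD_TSin {a b c a' b' c' : ℤ} (h : a + b + c = 0) (h' : a' + b' + c' = 0) :
    innerD (TSin (a, b, c)) (TSin (a', b', c')) =
      (1 / 6) * ((if (a, b, c) = (a', b', c') then 1 else 0) +
        (if (a, b, c) = (b', c', a') then 1 else 0) +
        (if (a, b, c) = (c', a', b') then 1 else 0) -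
        (if (a, b, c) = (-a', -c', -b') then 1 else 0) -
        (if (a, b, c) = (-b', -a', -c') then 1 else 0) -
        (if (a, b, c) = (-c', -b', -a') then 1 else 0)) := by
  have hT (m : ℤ × ℤ × ℤ) :
      Integrable (fun p => TCos m (emb p)) (volume.restrict TriDelta) := integrableOn_TCos m
  simp only [innerD, TSin_mul_conj]
  rw [integral_const_mul, integral_sub, integral_sub, integral_sub, integral_add, integral_add]
  · rw [setIntegral_TCos _ _ _ (by lia), setIntegral_TCos _ _ _ (by lia),
      setIntegral_TCos _ _ _ (by lia), setIntegral_TCos _ _ _ (by lia),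
      setIntegral_TCos _ _ _ (by lia), setIntegral_TCos _ _ _ (by lia)]
    simp only [Prod.mk.injEq, sub_eq_zero]
    ring
  all_goals fun_prop

theorem stmt_10 :
    (∀ k ∈ Lam, ∀ j ∈ Lam, k ≠ j → innerD (TCos k) (TCos j) = 0) ∧
    (innerD (TCos (0, 0, 0)) (TCos (0, 0, 0)) = 1) ∧
    (∀ k ∈ Lam, k ∉ LamCirc → k ≠ (0, 0, 0) → innerD (TCos k) (TCos k) = 1 / 3) ∧
    (∀ k ∈ LamCirc, innerD (TCos k) (TCos k) = 1 / 6) ∧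
    (∀ k ∈ LamCirc, ∀ j ∈ LamCirc,
      innerD (TSin k) (TSin j) = if k = j then 1 / 6 else 0) := by
  refine ⟨?_, ?_, ?_, ?_, ?_⟩
  · rintro ⟨a, b, c⟩ ⟨h, ha, hb, hc⟩ ⟨a', b', c'⟩ ⟨h', ha', hb', hc'⟩ hne
    dsimp only at *
    rw [innerD_TCos h h']
    simp only [ne_eq, Prod.mk.injEq] at *
    rw [if_neg (by lia), if_neg (by lia), if_neg (by lia), if_neg (by lia), if_neg (by lia),
      if_neg (by lia)]
    norm_num
  · rw [innerD_TCos (by norm_num) (by norm_num)]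
    norm_num
  · rintro ⟨a, b, c⟩ ⟨h, ha, hb, hc⟩ hk hne
    simp only [LamCirc, Set.mem_ofPred_eq, ne_eq, Prod.mk.injEq] at *
    rw [innerD_TCos h h]
    simp only [Prod.mk.injEq]
    rcases (by lia : a = 0 ∧ b ≠ 0 ∨ a ≠ 0 ∧ b = 0) with hab | hab
    · rw [if_pos (by lia), if_neg (by lia), if_neg (by lia), if_pos (by lia), if_neg (by lia),
        if_neg (by lia)]
      norm_num
    · rw [if_pos (by lia), if_neg (by lia), if_neg (by lia), if_neg (by lia), if_neg (by lia),
        if_pos (by lia)]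
      norm_num
  · rintro ⟨a, b, c⟩ ⟨h, ha, hb, hc⟩
    dsimp only at *
    rw [innerD_TCos h h]
    simp only [Prod.mk.injEq]
    rw [if_pos (by lia), if_neg (by lia), if_neg (by lia), if_neg (by lia), if_neg (by lia),
      if_neg (by lia)]
    norm_num
  · rintro ⟨a, b, c⟩ ⟨h, ha, hb, hc⟩ ⟨a', b', c'⟩ ⟨h', ha', hb', hc'⟩
    dsimp only at *
    rw [innerD_TSin h h']
    simp only [Prod.mk.injEq]
    rw [if_neg (by lia : ¬(a = b' ∧ _)), if_neg (by lia : ¬(a = c' ∧ _)),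
      if_neg (by lia : ¬(a = -a' ∧ _)), if_neg (by lia : ¬(a = -b' ∧ _)),
      if_neg (by lia : ¬(a = -c' ∧ _))]
    split_ifs <;> norm_num
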